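/- Let Ū ∈ C_c^∞(ℝ³;ℝ³) be divergence-free, set ū(x,t) := t^{-1/2}·Ū(x/√t), and let θ be an admissible solution on [1,∞) of ∂ₜθ = Δθ − ū·∇θ. Then for every integer k ≥ 1 there exists a constant C = C(k, Ū) such that for all t > 1: ‖∇^k θ(·,t)‖²_{L²(ℝ³)} ≤ C·(t−1)^{−1}·‖θ(·,1)‖²_{H^{k−1}}. -/

import Mathlib

noncomputable section

open MeasureTheory
open scoped ENNReal BigOperators

/-- Three-dimensional Euclidean space. -/
abbrev E3 : Type := EuclideanSpace ℝ (Fin 3)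

/-- Spatial partial derivative `∂ᵢ F` of a scalar function. -/
noncomputable def pd (F : E3 → ℝ) (i : Fin 3) (x : E3) : ℝ :=
  fderiv ℝ F x (EuclideanSpace.single i 1)

/-- Laplacian `ΔF` of a scalar function. -/
noncomputable def lap (F : E3 → ℝ) (x : E3) : ℝ :=
  ∑ i, pd (fun y => pd F i y) i x

/-- Spatial divergence `∇·u` of a vector field. -/
noncomputable def divg (u : E3 → E3) (x : E3) : ℝ :=
  ∑ i, pd (fun y => u y i) i x

/-- The self-similar velocity field `ū(x,t) = t^{-1/2} Ū(x/√t)`. -/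
noncomputable def ubar (Ubar : E3 → E3) (x : E3) (t : ℝ) : E3 :=
  (t ^ (-(1:ℝ)/2)) • Ubar ((t ^ (-(1:ℝ)/2)) • x)

/-- The squared Sobolev `H^m` norm `∑_{j=0}^m ∫ ‖∇ʲ g‖²`. -/
noncomputable def sobSq (m : ℕ) (g : E3 → ℝ) : ℝ :=
  ∑ j ∈ Finset.range (m + 1), ∫ x : E3, ‖iteratedFDeriv ℝ j g x‖ ^ 2

/-- `θ` is an admissible solution on `ℝ³ × [1,∞)` of the advected heat equation
`∂ₜθ = Δθ − ū·∇θ`: it is smooth, solves the equation pointwise, and together with all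
its spatial derivatives decays in `x` faster than any polynomial, locally uniformly
in `t`. -/
def IsAdmissible (Ubar : E3 → E3) (θ : E3 → ℝ → ℝ) : Prop :=
  ContDiffOn ℝ (⊤ : ℕ∞) (fun q : E3 × ℝ => θ q.1 q.2) {q : E3 × ℝ | 1 ≤ q.2} ∧
  (∀ (x : E3) (t : ℝ), 1 ≤ t →
    deriv (fun s => θ x s) t
      = lap (fun y => θ y t) x - ∑ i, ubar Ubar x t i * pd (fun y => θ y t) i x) ∧
  (∀ (n k : ℕ) (T : ℝ), ∃ C : ℝ, ∀ (x : E3) (t : ℝ), 1 ≤ t → t ≤ T →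
    ‖x‖ ^ n * ‖iteratedFDeriv ℝ k (fun y => θ y t) x‖ ≤ C)

/-- Iterated spatial partial derivative along a word of coordinate directions. -/
def wordDeriv : List (Fin 3) → (E3 → ℝ) → E3 → ℝ
  | [], f => f
  | i :: w, f => pd (wordDeriv w f) i

lemma wordDeriv_cons (i : Fin 3) (w : List (Fin 3)) (f : E3 → ℝ) :
    wordDeriv (i :: w) f = pd (wordDeriv w f) i := rfl

section PartialDerivatives

variable {f g : E3 → ℝ}

lemma contDiff_pd (hf : ContDiff ℝ (⊤ : ℕ∞) f) (i : Fin 3) : ContDiff ℝ (⊤ : ℕ∞) (pd f i) :=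
  (hf.fderiv_right (m := (⊤ : ℕ∞)) (by simp)).clm_apply contDiff_const

lemma contDiff_wordDeriv (hf : ContDiff ℝ (⊤ : ℕ∞) f) (w : List (Fin 3)) :
    ContDiff ℝ (⊤ : ℕ∞) (wordDeriv w f) := by
  induction w with
  | nil => exact hf
  | cons i w ih => exact contDiff_pd ih i

lemma pd_add (hf : ContDiff ℝ (⊤ : ℕ∞) f) (hg : ContDiff ℝ (⊤ : ℕ∞) g) (i : Fin 3) (x : E3) :
    pd (fun y => f y + g y) i x = pd f i x + pd g i x := by
  have := fderiv_fun_add (hf.differentiable (by simp) x) (hg.differentiable (by simp) x)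
  simp [pd, this]

lemma pd_sub (hf : ContDiff ℝ (⊤ : ℕ∞) f) (hg : ContDiff ℝ (⊤ : ℕ∞) g) (i : Fin 3) (x : E3) :
    pd (fun y => f y - g y) i x = pd f i x - pd g i x := by
  have := fderiv_fun_sub (hf.differentiable (by simp) x) (hg.differentiable (by simp) x)
  simp [pd, this]

lemma pd_mul (hf : ContDiff ℝ (⊤ : ℕ∞) f) (hg : ContDiff ℝ (⊤ : ℕ∞) g) (i : Fin 3) (x : E3) :
    pd (fun y => f y * g y) i x = pd f i x * g x + f x * pd g i x := by
  have := fderiv_fun_mul (hf.differentiable (by simp) x) (hg.differentiable (by simp) x)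
  simp [pd, this]
  ring

lemma pd_sum {F : Fin 3 → E3 → ℝ} (hF : ∀ j, ContDiff ℝ (⊤ : ℕ∞) (F j)) (i : Fin 3) (x : E3) :
    pd (fun y => ∑ j, F j y) i x = ∑ j, pd (F j) i x := by
  have := fderiv_fun_sum (u := Finset.univ) (fun j _ => (hF j).differentiable (by simp) x)
  simp [pd, this]

lemma pd_comm (hf : ContDiff ℝ (⊤ : ℕ∞) f) (i j : Fin 3) : pd (pd f i) j = pd (pd f j) i := by
  funext x
  have hd : DifferentiableAt ℝ (fderiv ℝ f) x :=
    (hf.fderiv_right (m := (⊤ : ℕ∞)) (by simp)).differentiable (by simp) x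
  have key : ∀ a b : Fin 3, pd (pd f a) b x
      = fderiv ℝ (fderiv ℝ f) x (EuclideanSpace.single b 1) (EuclideanSpace.single a 1) := by
    intro a b
    have := fderiv_clm_apply hd (differentiableAt_const (EuclideanSpace.single a (1 : ℝ)))
    change fderiv ℝ (fun y => fderiv ℝ f y (EuclideanSpace.single a 1)) x _ = _
    rw [this]
    simp
  rw [key, key]
  exact (hf.contDiffAt.isSymmSndFDerivAt (by
    simpa using WithTop.coe_le_coe.2 (le_top : (2 : ℕ∞) ≤ ⊤))) _ _

lemma pd_comp_smul (hf : ContDiff ℝ (⊤ : ℕ∞) f) (s : ℝ) (i : Fin 3) (x : E3) :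
    pd (fun y => f (s • y)) i x = s * pd f i (s • x) := by
  have h1 : HasFDerivAt (fun y : E3 => s • y) (s • ContinuousLinearMap.id ℝ E3) x :=
    (hasFDerivAt_id x).const_smul s
  have h2 := ((hf.differentiable (by simp) (s • x)).hasFDerivAt.comp x h1).fderiv
  have h3 : fderiv ℝ (fun y => f (s • y)) x
      = (fderiv ℝ f (s • x)).comp (s • ContinuousLinearMap.id ℝ E3) := h2
  simp [pd, h3]

lemma pd_const_mul (hf : ContDiff ℝ (⊤ : ℕ∞) f) (a : ℝ) (i : Fin 3) (x : E3) :
    pd (fun y => a * f y) i x = a * pd f i x := by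
  have := fderiv_const_mul (hf.differentiable (by simp) x) a
  simp [pd, this]

lemma wordDeriv_rescale (hf : ContDiff ℝ (⊤ : ℕ∞) f) (a s : ℝ) (w : List (Fin 3)) :
    wordDeriv w (fun y => a * f (s • y))
      = fun x => a * (s ^ w.length * wordDeriv w f (s • x)) := by
  induction w with
  | nil => simp [wordDeriv]
  | cons i w ih =>
    funext x
    have hw := contDiff_wordDeriv hf w
    have hw' : ContDiff ℝ (⊤ : ℕ∞) (fun y : E3 => wordDeriv w f (s • y)) :=
      hw.comp (contDiff_const_smul s)
    rw [wordDeriv_cons, ih, pd_const_mul (contDiff_const.mul hw'), pd_const_mul hw',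
      pd_comp_smul hw, wordDeriv_cons, List.length_cons]
    ring

lemma wordDeriv_append (u w : List (Fin 3)) (f : E3 → ℝ) :
    wordDeriv (u ++ w) f = wordDeriv u (wordDeriv w f) := by
  induction u with
  | nil => rfl
  | cons i u ih => rw [List.cons_append, wordDeriv_cons, wordDeriv_cons, ih]

lemma wordDeriv_eq_iteratedFDeriv (hf : ContDiff ℝ (⊤ : ℕ∞) f) (w : List (Fin 3)) (x : E3) :
    wordDeriv w f x
      = iteratedFDeriv ℝ w.length f x (fun j => EuclideanSpace.single (w.get j) 1) := by
  induction w generalizing x with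
  | nil => simp [wordDeriv]
  | cons i w ih =>
    have hd : DifferentiableAt ℝ (iteratedFDeriv ℝ w.length f) x :=
      hf.contDiffAt.differentiableAt_iteratedFDeriv (by exact_mod_cast WithTop.coe_lt_top _)
    rw [wordDeriv_cons, pd, funext ih]
    erw [iteratedFDeriv_succ_apply_left]
    rw [fderiv_continuousMultilinear_apply_const_apply hd]
    rfl

lemma abs_wordDeriv_le (hf : ContDiff ℝ (⊤ : ℕ∞) f) (w : List (Fin 3)) (x : E3) :
    |wordDeriv w f x| ≤ ‖iteratedFDeriv ℝ w.length f x‖ := by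
  rw [wordDeriv_eq_iteratedFDeriv hf, ← Real.norm_eq_abs]
  refine ((iteratedFDeriv ℝ w.length f x).le_opNorm _).trans ?_
  simp

lemma norm_iteratedFDeriv_le_sum (hf : ContDiff ℝ (⊤ : ℕ∞) f) (k : ℕ) (x : E3) :
    ‖iteratedFDeriv ℝ k f x‖ ≤ ∑ w : Fin k → Fin 3, |wordDeriv (List.ofFn w) f x| := by
  have hw : ∀ w : Fin k → Fin 3, wordDeriv (List.ofFn w) f x
      = iteratedFDeriv ℝ k f x (fun j => EuclideanSpace.single (w j) 1) := by
    intro w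
    rw [wordDeriv_eq_iteratedFDeriv hf]
    have : ∀ (n : ℕ) (hn : n = k) (v : Fin n → E3), iteratedFDeriv ℝ n f x v
        = iteratedFDeriv ℝ k f x (fun j => v (Fin.cast hn.symm j)) := by
      rintro n rfl v; rfl
    rw [this _ (List.length_ofFn)]
    simp
  refine ContinuousMultilinearMap.opNorm_le_bound (by positivity) fun v => ?_
  have hv : ∀ j, v j = ∑ a : Fin 3, v j a • EuclideanSpace.single a (1 : ℝ) := by
    intro j
    ext b
    simp [Pi.single_apply]
  have : v = fun j => ∑ a : Fin 3, v j a • EuclideanSpace.single a (1 : ℝ) := funext hv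
  conv_lhs => rw [this]
  rw [ContinuousMultilinearMap.map_sum, Finset.sum_mul]
  refine (norm_sum_le _ _).trans (Finset.sum_le_sum fun w _ => ?_)
  rw [ContinuousMultilinearMap.map_smul_univ, ← hw, norm_smul, mul_comm, Real.norm_eq_abs]
  gcongr
  rw [Real.norm_eq_abs, Finset.abs_prod]
  gcongr with j
  exact PiLp.norm_apply_le (v j) (w j)

end PartialDerivatives

/-- `f` is the underlying function of a Schwartz map. -/
def IsSchwartz (f : E3 → ℝ) : Prop := ∃ φ : SchwartzMap E3 ℝ, ⇑φ = f

/-- The squared `L²` norm of all partial derivatives of order `k`. -/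
def energy (k : ℕ) (f : E3 → ℝ) : ℝ :=
  ∑ w : Fin k → Fin 3, ∫ x, wordDeriv (List.ofFn w) f x ^ 2

namespace IsSchwartz

variable {f g : E3 → ℝ}

lemma contDiff (hf : IsSchwartz f) : ContDiff ℝ (⊤ : ℕ∞) f := by
  obtain ⟨φ, rfl⟩ := hf
  exact φ.smooth'

lemma partialDeriv (hf : IsSchwartz f) (i : Fin 3) : IsSchwartz (pd f i) := by
  obtain ⟨φ, rfl⟩ := hf
  refine ⟨LineDeriv.lineDerivOp (EuclideanSpace.single i (1 : ℝ)) φ, ?_⟩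
  funext x
  exact SchwartzMap.lineDerivOp_apply_eq_fderiv _ _ _

lemma wordPartial (hf : IsSchwartz f) (w : List (Fin 3)) : IsSchwartz (wordDeriv w f) := by
  induction w with
  | nil => exact hf
  | cons i w ih => exact ih.partialDeriv i

lemma integrable_mul (hf : IsSchwartz f) (hg : IsSchwartz g) :
    Integrable (fun x => f x * g x) := by
  obtain ⟨φ, rfl⟩ := hf
  obtain ⟨ψ, rfl⟩ := hg
  exact (φ.memLp 2).integrable_mul (ψ.memLp 2)

lemma integrable_sq (hf : IsSchwartz f) : Integrable (fun x => f x ^ 2) := by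
  simpa only [pow_two] using hf.integrable_mul hf

lemma integrable_bdd_mul_mul (hf : IsSchwartz f) (hg : IsSchwartz g) {b : E3 → ℝ}
    (hb : Continuous b) {C : ℝ} (hC : ∀ x, |b x| ≤ C) :
    Integrable (fun x => b x * (f x * g x)) :=
  (hf.integrable_mul hg).bdd_mul hb.aestronglyMeasurable (ae_of_all _ hC)

lemma integral_mul_pd (hf : IsSchwartz f) (hg : IsSchwartz g) (i : Fin 3) :
    ∫ x, f x * pd g i x = -∫ x, pd f i x * g x :=
  integral_mul_fderiv_eq_neg_fderiv_mul_of_integrable ((hf.partialDeriv i).integrable_mul hg)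
    (hf.integrable_mul (hg.partialDeriv i)) (hf.integrable_mul hg)
    (fun x _ => hf.contDiff.differentiable (by simp) x)
    (fun x _ => hg.contDiff.differentiable (by simp) x)

lemma integral_mul_lap (hg : IsSchwartz g) :
    ∫ x, g x * lap g x = -∑ i, ∫ x, pd g i x ^ 2 := by
  have h : ∀ x, g x * lap g x = ∑ i, g x * pd (pd g i) i x := fun x => by
    rw [lap, Finset.mul_sum]
  simp_rw [h]
  rw [integral_finsetSum _ fun i _ => hg.integrable_mul ((hg.partialDeriv i).partialDeriv i),
    ← Finset.sum_neg_distrib]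
  refine Finset.sum_congr rfl fun i _ => ?_
  rw [hg.integral_mul_pd (hg.partialDeriv i)]
  simp_rw [pow_two]

lemma integral_mul_transport (hg : IsSchwartz g) {b : Fin 3 → E3 → ℝ}
    (hb : ∀ i, ContDiff ℝ (⊤ : ℕ∞) (b i)) {C : ℝ} (hC : ∀ i x, |b i x| ≤ C)
    (hC' : ∀ i x, |pd (b i) i x| ≤ C) (hdiv : ∀ x, ∑ i, pd (b i) i x = 0) :
    ∫ x, g x * ∑ i, b i x * pd g i x = 0 := by
  have hI : ∀ i, Integrable (fun x => b i x * (g x * pd g i x)) := fun i =>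
    hg.integrable_bdd_mul_mul (hg.partialDeriv i) (hb i).continuous (hC i)
  have hI' : ∀ i, Integrable (fun x => pd (b i) i x * (g x * g x)) := fun i =>
    hg.integrable_bdd_mul_mul hg (contDiff_pd (hb i) i).continuous (hC' i)
  have key : ∀ i, ∫ x, b i x * (g x * pd g i x)
      = -(∫ x, pd (b i) i x * (g x * g x))
        - ∫ x, b i x * (g x * pd g i x) := by
    intro i
    have hp : ∀ x, pd (fun y => b i y * g y) i x * g x
        = pd (b i) i x * (g x * g x) + b i x * (g x * pd g i x) := fun x => by
      rw [pd_mul (hb i) hg.contDiff]; ring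
    have h := integral_mul_fderiv_eq_neg_fderiv_mul_of_integrable (μ := volume)
      (f := fun x => b i x * g x) (g := g) (v := EuclideanSpace.single i (1 : ℝ))
      (((hI' i).add (hI i)).congr (ae_of_all _ fun x => (hp x).symm))
      ((hI i).congr (ae_of_all _ fun x => by
        change b i x * (g x * pd g i x) = b i x * g x * pd g i x
        ring))
      ((hg.integrable_bdd_mul_mul hg (hb i).continuous (hC i)).congr
        (ae_of_all _ fun x => by ring))
      (fun x _ => ((hb i).mul hg.contDiff).differentiable (by simp) x)
      (fun x _ => hg.contDiff.differentiable (by simp) x)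
    change ∫ x, b i x * g x * pd g i x
      = -∫ x, pd (fun y => b i y * g y) i x * g x at h
    simp_rw [hp] at h
    rw [integral_add (hI' i) (hI i)] at h
    simp_rw [mul_assoc] at h
    linarith
  have hsum : ∑ i, ∫ x, pd (b i) i x * (g x * g x) = 0 := by
    rw [← integral_finsetSum _ fun i _ => hI' i]
    simp_rw [← Finset.sum_mul, hdiv]
    simp
  have hx : ∀ x, g x * ∑ i, b i x * pd g i x
      = ∑ i, b i x * (g x * pd g i x) := fun x => by
    rw [Finset.mul_sum]
    exact Finset.sum_congr rfl fun i _ => by ring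
  simp_rw [hx]
  rw [integral_finsetSum _ fun i _ => hI i]
  have h2 := Finset.sum_congr (rfl : (Finset.univ : Finset (Fin 3)) = _) fun i _ => key i
  rw [Finset.sum_sub_distrib, Finset.sum_neg_distrib, hsum] at h2
  linarith

lemma norm_iteratedFDeriv_sq_le (hf : IsSchwartz f) (k : ℕ) (x : E3) :
    ‖iteratedFDeriv ℝ k f x‖ ^ 2
      ≤ 3 ^ k * ∑ w : Fin k → Fin 3, wordDeriv (List.ofFn w) f x ^ 2 := by
  have h1 := pow_le_pow_left₀ (norm_nonneg _) (norm_iteratedFDeriv_le_sum hf.contDiff k x) 2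
  have h2 := sq_sum_le_card_mul_sum_sq (s := Finset.univ)
    (f := fun w : Fin k → Fin 3 => |wordDeriv (List.ofFn w) f x|)
  simp only [sq_abs, Finset.card_univ, Fintype.card_fun, Fintype.card_fin] at h2
  push_cast at h2
  exact h1.trans h2

lemma integrable_sum_sq (hf : IsSchwartz f) (k : ℕ) :
    Integrable (fun x => ∑ w : Fin k → Fin 3, wordDeriv (List.ofFn w) f x ^ 2) :=
  integrable_finsetSum _ fun _ _ => (hf.wordPartial _).integrable_sq

lemma integral_norm_iteratedFDeriv_sq_le (hf : IsSchwartz f) (k : ℕ) :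
    ∫ x, ‖iteratedFDeriv ℝ k f x‖ ^ 2 ≤ 3 ^ k * energy k f := by
  rw [energy, ← integral_finsetSum _ fun w _ => (hf.wordPartial _).integrable_sq,
    ← integral_const_mul]
  exact integral_mono_of_nonneg (ae_of_all _ fun x => by positivity)
    ((hf.integrable_sum_sq k).const_mul _) (ae_of_all _ (hf.norm_iteratedFDeriv_sq_le k))

lemma energy_le_integral (hf : IsSchwartz f) (k : ℕ) :
    energy k f ≤ 3 ^ k * ∫ x, ‖iteratedFDeriv ℝ k f x‖ ^ 2 := by
  have hI : Integrable (fun x => ‖iteratedFDeriv ℝ k f x‖ ^ 2) := by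
    refine ((hf.integrable_sum_sq k).const_mul (3 ^ k)).mono' ?_ (ae_of_all _ fun x => ?_)
    · exact ((hf.contDiff.continuous_iteratedFDeriv (by
        exact_mod_cast le_top)).norm.pow 2).aestronglyMeasurable
    · rw [Real.norm_of_nonneg (by positivity)]
      exact hf.norm_iteratedFDeriv_sq_le k x
  have h (w : Fin k → Fin 3) : ∫ x, wordDeriv (List.ofFn w) f x ^ 2
      ≤ ∫ x, ‖iteratedFDeriv ℝ k f x‖ ^ 2 := by
    refine integral_mono (hf.wordPartial _).integrable_sq hI fun x => ?_
    have := abs_wordDeriv_le hf.contDiff (List.ofFn w) x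
    rw [List.length_ofFn] at this
    simpa using pow_le_pow_left₀ (abs_nonneg _) this 2
  exact (Finset.sum_le_sum fun w _ => h w).trans (by simp)

end IsSchwartz

lemma energy_nonneg (k : ℕ) (f : E3 → ℝ) : 0 ≤ energy k f :=
  Finset.sum_nonneg fun _ _ => integral_nonneg fun _ => sq_nonneg _

lemma integral_sq_le_energy (f : E3 → ℝ) (v : List (Fin 3)) :
    ∫ x, wordDeriv v f x ^ 2 ≤ energy v.length f := by
  have h := Finset.single_le_sum
    (f := fun w : Fin v.length → Fin 3 => ∫ x, wordDeriv (List.ofFn w) f x ^ 2)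
    (fun _ _ => integral_nonneg fun _ => sq_nonneg _) (Finset.mem_univ v.get)
  simpa [energy] using h

lemma energy_succ (k : ℕ) (f : E3 → ℝ) :
    energy (k + 1) f
      = ∑ w : Fin k → Fin 3, ∑ i, ∫ x, pd (wordDeriv (List.ofFn w) f) i x ^ 2 := by
  rw [energy, ← (Fin.consEquiv fun _ => Fin 3).sum_comp, Fintype.sum_prod_type_right]
  simp [Fin.consEquiv, List.ofFn_succ, wordDeriv]

lemma IsSchwartz.exists_bound {f : E3 → ℝ} (hf : IsSchwartz f) (w : List (Fin 3)) :
    ∃ C, ∀ x, |wordDeriv w f x| ≤ C := by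
  obtain ⟨φ, rfl⟩ := hf
  obtain ⟨C, hC⟩ := φ.decay' 0 w.length
  exact ⟨C, fun x => (abs_wordDeriv_le φ.smooth' w x).trans (by simpa using hC x)⟩

lemma IsSchwartz.of_hasCompactSupport {f : E3 → ℝ} (hf : ContDiff ℝ (⊤ : ℕ∞) f)
    (hc : HasCompactSupport f) : IsSchwartz f :=
  ⟨hc.toSchwartzMap hf, rfl⟩

/-- Smooth coefficients all of whose spatial derivatives are `O(1/t)` uniformly on `t ≥ 1`. -/
def IsCoeff (c : E3 → ℝ → ℝ) : Prop :=
  (∀ t, 1 ≤ t → ContDiff ℝ (⊤ : ℕ∞) (fun x => c x t)) ∧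
  ∀ w : List (Fin 3), ∃ C : ℝ, ∀ x t, 1 ≤ t → |wordDeriv w (fun y => c y t) x| ≤ C * t⁻¹

lemma IsCoeff.partialDeriv {c : E3 → ℝ → ℝ} (hc : IsCoeff c) (i : Fin 3) :
    IsCoeff (fun x t => pd (fun y => c y t) i x) := by
  refine ⟨fun t ht => contDiff_pd (hc.1 t ht) i, fun w => ?_⟩
  obtain ⟨C, hC⟩ := hc.2 (w ++ [i])
  refine ⟨C, fun x t ht => ?_⟩
  have := hC x t ht
  rwa [wordDeriv_append] at this

/-- Linear differential operators with coefficients in `IsCoeff` involving only derivatives of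
orders between `1` and `k`. -/
inductive IsLowerOrder (k : ℕ) : ((E3 → ℝ) → E3 → ℝ → ℝ) → Prop
  | zero : IsLowerOrder k (fun _ _ _ => 0)
  | add {S T : (E3 → ℝ) → E3 → ℝ → ℝ} (hS : IsLowerOrder k S) (hT : IsLowerOrder k T) :
      IsLowerOrder k (fun f x t => S f x t + T f x t)
  | monomial {c : E3 → ℝ → ℝ} {v : List (Fin 3)} (hc : IsCoeff c) (h1 : 1 ≤ v.length)
      (h2 : v.length ≤ k) : IsLowerOrder k (fun f x t => c x t * wordDeriv v f x)

namespace IsLowerOrder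

variable {k : ℕ} {T : (E3 → ℝ) → E3 → ℝ → ℝ}

lemma contDiff (hT : IsLowerOrder k T) {f : E3 → ℝ} (hf : ContDiff ℝ (⊤ : ℕ∞) f) {t : ℝ}
    (ht : 1 ≤ t) : ContDiff ℝ (⊤ : ℕ∞) (fun x => T f x t) := by
  induction hT with
  | zero => exact contDiff_const
  | add _ _ ihS ihT => exact ihS.add ihT
  | monomial hc _ _ => exact (hc.1 t ht).mul (contDiff_wordDeriv hf _)

lemma exists_partialDeriv (hT : IsLowerOrder k T) (i : Fin 3) :
    ∃ T', IsLowerOrder (k + 1) T' ∧ ∀ f : E3 → ℝ, ContDiff ℝ (⊤ : ℕ∞) f → ∀ t, 1 ≤ t → ∀ x,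
      pd (fun y => T f y t) i x = T' f x t := by
  induction hT with
  | zero => exact ⟨_, zero, fun f _ t _ x => by simp [pd]⟩
  | add hS hT ihS ihT =>
    obtain ⟨S', hS', hS''⟩ := ihS
    obtain ⟨T', hT', hT''⟩ := ihT
    refine ⟨_, hS'.add hT', fun f hf t ht x => ?_⟩
    rw [pd_add (hS.contDiff hf ht) (hT.contDiff hf ht), hS'' f hf t ht, hT'' f hf t ht]
  | @monomial c v hc h1 h2 =>
    refine ⟨_, (monomial (hc.partialDeriv i) h1 (by omega)).add
      (monomial (v := i :: v) hc (by simp) (by simpa using h2)), fun f hf t ht x => ?_⟩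
    rw [pd_mul (hc.1 t ht) (contDiff_wordDeriv hf v)]
    rfl

lemma exists_bound (hT : IsLowerOrder k T) : ∃ C, 0 ≤ C ∧ ∀ f t x M, 1 ≤ t →
    (∀ v : List (Fin 3), v.length ≤ k → |wordDeriv v f x| ≤ M) → |T f x t| ≤ C * M := by
  induction hT with
  | zero => exact ⟨0, le_rfl, fun _ _ _ _ _ _ => by simp⟩
  | add _ _ ihS ihT =>
    obtain ⟨A, hA, hA'⟩ := ihS
    obtain ⟨B, hB, hB'⟩ := ihT
    refine ⟨A + B, by positivity, fun f t x M ht hM => (abs_add_le _ _).trans ?_⟩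
    linarith [hA' f t x M ht hM, hB' f t x M ht hM]
  | @monomial c v hc h1 h2 =>
    obtain ⟨C, hC⟩ := hc.2 []
    have hC0 : 0 ≤ C := by simpa using (abs_nonneg _).trans (hC 0 1 le_rfl)
    refine ⟨C, hC0, fun f t x M ht hM => ?_⟩
    rw [abs_mul]
    have h : |c x t| ≤ C := (hC x t ht).trans
      (mul_le_of_le_one_right hC0 (inv_le_one_of_one_le₀ ht))
    exact mul_le_mul h (hM v h2) (abs_nonneg _) hC0

lemma exists_integral_bound (hT : IsLowerOrder k T) {w : List (Fin 3)} (hwk : w.length = k) :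
    ∃ C, 0 ≤ C ∧ ∀ f, IsSchwartz f → ∀ t, 1 ≤ t →
      Integrable (fun x => wordDeriv w f x * T f x t) ∧
      |∫ x, wordDeriv w f x * T f x t| ≤ C * t⁻¹ * ∑ m ∈ Finset.Icc 1 k, energy m f := by
  induction hT with
  | zero => exact ⟨0, le_rfl, fun _ _ _ _ => by simp⟩
  | add hS hT ihS ihT =>
    obtain ⟨A, hA, hA'⟩ := ihS
    obtain ⟨B, hB, hB'⟩ := ihT
    refine ⟨A + B, by positivity, fun f hf t ht => ?_⟩
    obtain ⟨iS, bS⟩ := hA' f hf t ht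
    obtain ⟨iT, bT⟩ := hB' f hf t ht
    simp_rw [mul_add]
    refine ⟨iS.add iT, ?_⟩
    rw [integral_add iS iT]
    refine (abs_add_le _ _).trans ?_
    linarith
  | @monomial c v hc hv1 hv2 =>
    obtain ⟨C, hC⟩ := hc.2 []
    have hC0 : 0 ≤ C := by simpa using (abs_nonneg _).trans (hC 0 1 le_rfl)
    refine ⟨C, hC0, fun f hf t ht => ?_⟩
    have hw := hf.wordPartial w
    have hv := hf.wordPartial v
    have hsingle : ∀ u : List (Fin 3), 1 ≤ u.length → u.length ≤ k →
        ∫ x, wordDeriv u f x ^ 2 ≤ ∑ m ∈ Finset.Icc 1 k, energy m f := fun u hu1 hu2 =>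
      (integral_sq_le_energy f u).trans (Finset.single_le_sum (f := fun m => energy m f)
        (fun m _ => energy_nonneg m f) (Finset.mem_Icc.2 ⟨hu1, hu2⟩))
    have hI : Integrable (fun x => c x t * (wordDeriv w f x * wordDeriv v f x)) :=
      hw.integrable_bdd_mul_mul hv (hc.1 t ht).continuous fun x => hC x t ht
    have hx : ∀ x, wordDeriv w f x * (c x t * wordDeriv v f x)
        = c x t * (wordDeriv w f x * wordDeriv v f x) := fun x => by ring
    simp_rw [hx]
    refine ⟨hI, abs_integral_le_integral_abs.trans ?_⟩
    have hJ : Integrable (fun x => C * t⁻¹ * (2⁻¹ * (wordDeriv w f x ^ 2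
        + wordDeriv v f x ^ 2))) :=
      ((hw.integrable_sq.add hv.integrable_sq).const_mul _).const_mul _
    have hCt : 0 ≤ C * t⁻¹ := by positivity
    refine (integral_mono hI.abs hJ fun x => ?_).trans ?_
    · simp only [abs_mul]
      refine mul_le_mul (hC x t ht) ?_ (by positivity) hCt
      nlinarith [sq_nonneg (|wordDeriv w f x| - |wordDeriv v f x|),
        sq_abs (wordDeriv w f x), sq_abs (wordDeriv v f x)]
    · rw [integral_const_mul, integral_const_mul, integral_add hw.integrable_sq hv.integrable_sq]
      refine mul_le_mul_of_nonneg_left ?_ hCt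
      linarith [hsingle w (by omega) hwk.le, hsingle v hv1 hv2]

end IsLowerOrder

section Velocity

variable {Ubar : E3 → E3}

lemma ubar_apply (x : E3) (t : ℝ) (i : Fin 3) :
    ubar Ubar x t i = t ^ (-(1 : ℝ) / 2) * Ubar (t ^ (-(1 : ℝ) / 2) • x) i := by
  simp [ubar]

lemma contDiff_component (hU : ContDiff ℝ (⊤ : ℕ∞) Ubar) (i : Fin 3) :
    ContDiff ℝ (⊤ : ℕ∞) (fun x => Ubar x i) :=
  contDiff_euclidean.1 hU i

lemma isSchwartz_component (hU : ContDiff ℝ (⊤ : ℕ∞) Ubar) (hUc : HasCompactSupport Ubar)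
    (i : Fin 3) : IsSchwartz (fun x => Ubar x i) :=
  .of_hasCompactSupport (contDiff_component hU i)
    (hUc.comp_left (g := fun y : E3 => y i) (by simp))

lemma contDiff_ubar (hU : ContDiff ℝ (⊤ : ℕ∞) Ubar) (t : ℝ) (i : Fin 3) :
    ContDiff ℝ (⊤ : ℕ∞) (fun x => ubar Ubar x t i) := by
  simp_rw [ubar_apply]
  exact contDiff_const.mul ((contDiff_component hU i).comp (contDiff_const_smul _))

lemma rpow_neg_half_sq {t : ℝ} (ht : 1 ≤ t) :
    t ^ (-(1 : ℝ) / 2) * t ^ (-(1 : ℝ) / 2) = t⁻¹ := by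
  rw [← Real.rpow_add (by linarith), ← Real.rpow_neg_one]
  norm_num

lemma rpow_neg_half_le_one {t : ℝ} (ht : 1 ≤ t) : t ^ (-(1 : ℝ) / 2) ≤ 1 :=
  Real.rpow_le_one_of_one_le_of_nonpos ht (by norm_num)

lemma exists_ubar_bound (hU : ContDiff ℝ (⊤ : ℕ∞) Ubar) (hUc : HasCompactSupport Ubar) :
    ∃ C, ∀ i x t, 1 ≤ t → |ubar Ubar x t i| ≤ C := by
  choose C hC using fun i => (isSchwartz_component hU hUc i).exists_bound []
  have hC0 : ∀ i, 0 ≤ C i := fun i => (abs_nonneg _).trans (hC i 0)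
  refine ⟨∑ i, C i, fun i x t ht => ?_⟩
  rw [ubar_apply, abs_mul, abs_of_nonneg (by positivity)]
  refine ((mul_le_of_le_one_left (abs_nonneg _) (rpow_neg_half_le_one ht)).trans
    (hC i _)).trans (Finset.single_le_sum (fun j _ => hC0 j) (Finset.mem_univ i))

lemma isCoeff_pd_ubar (hU : ContDiff ℝ (⊤ : ℕ∞) Ubar) (hUc : HasCompactSupport Ubar)
    (i j : Fin 3) : IsCoeff (fun x t => pd (fun y => ubar Ubar y t j) i x) := by
  refine ⟨fun t _ => contDiff_pd (contDiff_ubar hU t j) i, fun w => ?_⟩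
  obtain ⟨C, hC⟩ := (isSchwartz_component hU hUc j).exists_bound (w ++ [i])
  refine ⟨C, fun x t ht => ?_⟩
  have h : wordDeriv w (fun x => pd (fun y => ubar Ubar y t j) i x)
      = wordDeriv (w ++ [i]) (fun y => ubar Ubar y t j) := by
    rw [wordDeriv_append]; rfl
  have hs0 : 0 ≤ t ^ (-(1 : ℝ) / 2) := by positivity
  rw [h]
  simp_rw [ubar_apply]
  rw [wordDeriv_rescale (contDiff_component hU j), List.length_append, List.length_singleton,
    abs_mul, abs_mul, pow_succ, abs_of_nonneg hs0, abs_of_nonneg (by positivity)]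
  calc _ = (t ^ (-(1 : ℝ) / 2)) ^ w.length * t⁻¹ *
        |wordDeriv (w ++ [i]) (fun y => Ubar y j) (t ^ (-(1 : ℝ) / 2) • x)| := by
        rw [← rpow_neg_half_sq ht]; ring
    _ ≤ 1 * t⁻¹ * C := by
        gcongr
        · exact pow_le_one₀ hs0 (rpow_neg_half_le_one ht)
        · exact hC _
    _ = C * t⁻¹ := by ring

lemma sum_pd_ubar (hU : ContDiff ℝ (⊤ : ℕ∞) Ubar) (hUdiv : ∀ x, divg Ubar x = 0) (x : E3)
    (t : ℝ) : ∑ i, pd (fun y => ubar Ubar y t i) i x = 0 := by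
  have h : ∀ i, pd (fun y => ubar Ubar y t i) i x
      = t ^ (-(1 : ℝ) / 2) * t ^ (-(1 : ℝ) / 2) *
        pd (fun y => Ubar y i) i (t ^ (-(1 : ℝ) / 2) • x) := fun i => by
    have := congrFun (wordDeriv_rescale (contDiff_component hU i) (t ^ (-(1 : ℝ) / 2))
      (t ^ (-(1 : ℝ) / 2)) [i]) x
    simp_rw [ubar_apply]
    refine this.trans ?_
    simp only [List.length_singleton, pow_one, wordDeriv]
    ring
  simp_rw [h, ← Finset.mul_sum]
  have := hUdiv (t ^ (-(1 : ℝ) / 2) • x)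
  rw [divg] at this
  rw [this, mul_zero]

/-- Commutator of an iterated partial derivative with the transport operator. -/
lemma exists_commutator (hU : ContDiff ℝ (⊤ : ℕ∞) Ubar) (hUc : HasCompactSupport Ubar)
    (w : List (Fin 3)) : ∃ T, IsLowerOrder w.length T ∧
      ∀ f : E3 → ℝ, ContDiff ℝ (⊤ : ℕ∞) f → ∀ t, 1 ≤ t → ∀ x,
        wordDeriv w (fun y => ∑ i, ubar Ubar y t i * pd f i y) x
          = (∑ i, ubar Ubar x t i * pd (wordDeriv w f) i x) + T f x t := by
  induction w with
  | nil => exact ⟨_, .zero, fun f _ t _ x => by simp [wordDeriv]⟩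
  | cons i w ih =>
    obtain ⟨T, hT, hT'⟩ := ih
    obtain ⟨T', hT1, hT2⟩ := hT.exists_partialDeriv i
    have hm : ∀ j, IsLowerOrder (i :: w).length (fun f x t =>
        pd (fun y => ubar Ubar y t j) i x * wordDeriv (j :: w) f x) := fun j =>
      .monomial (isCoeff_pd_ubar hU hUc i j) (by simp) (by simp)
    refine ⟨_, (((hm 0).add (hm 1)).add (hm 2)).add hT1, fun f hf t ht x => ?_⟩
    have hw := contDiff_wordDeriv hf w
    have hF : ∀ j, ContDiff ℝ (⊤ : ℕ∞)
        (fun y => ubar Ubar y t j * pd (wordDeriv w f) j y) := fun j =>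
      (contDiff_ubar hU t j).mul (contDiff_pd hw j)
    rw [wordDeriv_cons, funext (hT' f hf t ht),
      pd_add (ContDiff.sum fun j _ => hF j) (hT.contDiff hf ht), pd_sum hF, hT2 f hf t ht]
    simp_rw [fun j => pd_mul (contDiff_ubar hU t j) (contDiff_pd hw j) i x, pd_comm hw _ i,
      Fin.sum_univ_three, wordDeriv_cons]
    ring

lemma pd_lap {f : E3 → ℝ} (hf : ContDiff ℝ (⊤ : ℕ∞) f) (i : Fin 3) :
    pd (lap f) i = lap (pd f i) := by
  funext x
  have h : lap f = fun x => ∑ j, pd (pd f j) j x := rfl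
  rw [h, pd_sum fun j => contDiff_pd (contDiff_pd hf j) j, lap]
  refine Finset.sum_congr rfl fun j _ => ?_
  change pd (pd (pd f j) j) i x = pd (pd (pd f i) j) j x
  rw [pd_comm (contDiff_pd hf j), pd_comm hf j i]

lemma wordDeriv_lap {f : E3 → ℝ} (hf : ContDiff ℝ (⊤ : ℕ∞) f) (w : List (Fin 3)) :
    wordDeriv w (lap f) = lap (wordDeriv w f) := by
  induction w with
  | nil => rfl
  | cons i w ih => rw [wordDeriv_cons, ih, pd_lap (contDiff_wordDeriv hf w), wordDeriv_cons]

lemma contDiff_lap {f : E3 → ℝ} (hf : ContDiff ℝ (⊤ : ℕ∞) f) : ContDiff ℝ (⊤ : ℕ∞) (lap f) :=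
  ContDiff.sum fun i _ => contDiff_pd (contDiff_pd hf i) i

lemma wordDeriv_sub {f g : E3 → ℝ} (hf : ContDiff ℝ (⊤ : ℕ∞) f) (hg : ContDiff ℝ (⊤ : ℕ∞) g)
    (w : List (Fin 3)) (x : E3) :
    wordDeriv w (fun y => f y - g y) x = wordDeriv w f x - wordDeriv w g x := by
  induction w generalizing x with
  | nil => rfl
  | cons i w ih =>
    rw [wordDeriv_cons, funext ih, pd_sub (contDiff_wordDeriv hf w) (contDiff_wordDeriv hg w)]
    rfl

end Velocity

section TimeDependence

variable {Ubar : E3 → E3} {θ : E3 → ℝ → ℝ}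

/-- Smoothness on the closed slab `t ≥ 1`. -/
def IsSmoothFrom (θ : E3 → ℝ → ℝ) : Prop :=
  ContDiffOn ℝ (⊤ : ℕ∞) (fun q : E3 × ℝ => θ q.1 q.2) {q : E3 × ℝ | 1 ≤ q.2}

lemma uniqueDiffOn_slab : UniqueDiffOn ℝ {q : E3 × ℝ | 1 ≤ q.2} := by
  have h : {q : E3 × ℝ | 1 ≤ q.2} = Set.univ ×ˢ Set.Ici 1 := by
    ext q
    simp
  rw [h]
  exact uniqueDiffOn_univ.prod (uniqueDiffOn_Ici 1)

lemma hasFDerivAt_slice (x : E3) (t : ℝ) :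
    HasFDerivAt (fun y : E3 => (y, t)) (ContinuousLinearMap.inl ℝ E3 ℝ) x :=
  (hasFDerivAt_id x).prodMk (hasFDerivAt_const t x)

lemma IsSmoothFrom.contDiff_slice (h : IsSmoothFrom θ) {t : ℝ} (ht : 1 ≤ t) :
    ContDiff ℝ (⊤ : ℕ∞) (fun x => θ x t) :=
  contDiffOn_univ.1 <| ContDiffOn.comp (g := fun q : E3 × ℝ => θ q.1 q.2) h
    (f := fun x : E3 => (x, t)) (contDiff_id.prodMk contDiff_const).contDiffOn fun _ _ => ht

lemma IsSmoothFrom.continuousOn_time (h : IsSmoothFrom θ) (x : E3) :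
    ContinuousOn (fun t => θ x t) (Set.Ici 1) :=
  ContinuousOn.comp (g := fun q : E3 × ℝ => θ q.1 q.2) h.continuousOn
    (f := fun t : ℝ => (x, t)) (by fun_prop) fun _ ht => ht

lemma IsSmoothFrom.partialDeriv (h : IsSmoothFrom θ) (i : Fin 3) :
    IsSmoothFrom (fun x t => pd (fun y => θ y t) i x) := by
  have hF : ContDiffOn ℝ (⊤ : ℕ∞) (fderivWithin ℝ (fun q : E3 × ℝ => θ q.1 q.2)
      {q : E3 × ℝ | 1 ≤ q.2}) {q : E3 × ℝ | 1 ≤ q.2} :=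
    ContDiffOn.fderivWithin h uniqueDiffOn_slab (by simp)
  refine (hF.clm_apply (contDiffOn_const (c := ((EuclideanSpace.single i (1 : ℝ) : E3),
    (0 : ℝ))))).congr fun q hq => ?_
  have h1 : HasFDerivWithinAt (fun q : E3 × ℝ => θ q.1 q.2) _ {q : E3 × ℝ | 1 ≤ q.2} q :=
    (h.differentiableOn (by simp) q hq).hasFDerivWithinAt
  have h3 := HasFDerivWithinAt.comp (g := fun q : E3 × ℝ => θ q.1 q.2) (s := Set.univ) q.1 h1
    (hasFDerivAt_slice q.1 q.2).hasFDerivWithinAt fun _ _ => hq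
  have h4 : HasFDerivAt (fun y => θ y q.2) _ q.1 := hasFDerivWithinAt_univ.1 h3
  change pd (fun y => θ y q.2) i q.1 = _
  rw [pd, h4.fderiv]
  simp

lemma IsSmoothFrom.wordDeriv (h : IsSmoothFrom θ) (w : List (Fin 3)) :
    IsSmoothFrom (fun x t => wordDeriv w (fun y => θ y t) x) := by
  induction w with
  | nil => exact h
  | cons i w ih => exact ih.partialDeriv i

lemma IsSmoothFrom.contDiffAt (h : IsSmoothFrom θ) (x : E3) {t : ℝ} (ht : 1 < t) :
    ContDiffAt ℝ (⊤ : ℕ∞) (fun q : E3 × ℝ => θ q.1 q.2) (x, t) :=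
  ContDiffOn.contDiffAt h <| Filter.mem_of_superset
    ((isOpen_lt continuous_const continuous_snd).mem_nhds ht) fun q hq =>
      le_of_lt (show 1 < q.2 from hq)

lemma IsSmoothFrom.hasDerivAt_time (h : IsSmoothFrom θ) (x : E3) {t : ℝ} (ht : 1 < t) :
    HasDerivAt (fun s => θ x s)
      (fderiv ℝ (fun q : E3 × ℝ => θ q.1 q.2) (x, t) (0, 1)) t :=
  HasFDerivAt.comp_hasDerivAt (l := fun q : E3 × ℝ => θ q.1 q.2) (f := fun s => (x, s)) t
    ((h.contDiffAt x ht).differentiableAt (by simp)).hasFDerivAt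
    ((hasDerivAt_const t x).prodMk (hasDerivAt_id t))

lemma IsSmoothFrom.pd_eq (h : IsSmoothFrom θ) (i : Fin 3) (x : E3) {t : ℝ} (ht : 1 < t) :
    pd (fun y => θ y t) i x = fderiv ℝ (fun q : E3 × ℝ => θ q.1 q.2) (x, t)
      (EuclideanSpace.single i 1, 0) := by
  have h1 := ((h.contDiffAt x ht).differentiableAt (by simp)).hasFDerivAt.comp x
    (hasFDerivAt_slice x t)
  have h2 : HasFDerivAt (fun y => θ y t) _ x := h1
  rw [pd, h2.fderiv]
  simp

/-- Time derivatives commute with spatial partial derivatives. -/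
lemma IsSmoothFrom.hasDerivAt_pd (h : IsSmoothFrom θ) {t : ℝ} (ht : 1 < t) {θ' : E3 → ℝ}
    (hθ' : ∀ x, HasDerivAt (fun s => θ x s) (θ' x) t) (i : Fin 3) (x : E3) :
    HasDerivAt (fun s => pd (fun y => θ y s) i x) (pd θ' i x) t := by
  set G : E3 × ℝ → ℝ := fun q => θ q.1 q.2 with hG
  have hθ : θ' = fun y => fderiv ℝ G (y, t) (0, 1) :=
    funext fun y => (hθ' y).unique (h.hasDerivAt_time y ht)
  have hs : ContDiffAt ℝ (⊤ : ℕ∞) G (x, t) := h.contDiffAt x ht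
  have hd : HasFDerivAt (fderiv ℝ G) (fderiv ℝ (fderiv ℝ G) (x, t)) (x, t) :=
    ((hs.fderiv_right (m := (⊤ : ℕ∞)) (by simp)).differentiableAt (by simp)).hasFDerivAt
  have h1 : HasFDerivAt (fun y => fderiv ℝ G (y, t)) _ x :=
    hd.comp x (hasFDerivAt_slice x t)
  have h2 := (h1.clm_apply (hasFDerivAt_const ((0, 1) : E3 × ℝ) x)).fderiv
  have h3 : HasDerivAt (fun s => fderiv ℝ G (x, s)) (fderiv ℝ (fderiv ℝ G) (x, t) (0, 1)) t :=
    hd.comp_hasDerivAt t ((hasDerivAt_const t x).prodMk (hasDerivAt_id t))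
  have h4 := h3.clm_apply (hasDerivAt_const t ((EuclideanSpace.single i (1 : ℝ) : E3), (0 : ℝ)))
  have hsymm := hs.isSymmSndFDerivAt (by
    simpa using WithTop.coe_le_coe.2 (le_top : (2 : ℕ∞) ≤ ⊤)) (0, 1)
      (EuclideanSpace.single i (1 : ℝ), 0)
  have h5 : HasDerivAt (fun s => fderiv ℝ G (x, s) (EuclideanSpace.single i 1, 0))
      (pd θ' i x) t := by
    refine h4.congr_deriv ?_
    rw [hθ, pd, h2]
    simp [hsymm]
  refine h5.congr_of_eventuallyEq ?_
  filter_upwards [lt_mem_nhds ht] with s hs'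
  exact h.pd_eq i x hs'

lemma IsSmoothFrom.hasDerivAt_wordDeriv (h : IsSmoothFrom θ) {t : ℝ} (ht : 1 < t) {θ' : E3 → ℝ}
    (hθ' : ∀ x, HasDerivAt (fun s => θ x s) (θ' x) t) (w : List (Fin 3)) (x : E3) :
    HasDerivAt (fun s => _root_.wordDeriv w (fun y => θ y s) x) (_root_.wordDeriv w θ' x) t := by
  induction w generalizing x with
  | nil => exact hθ' x
  | cons i w ih => exact (h.wordDeriv w).hasDerivAt_pd ht ih i x

lemma IsAdmissible.isSmoothFrom (hθ : IsAdmissible Ubar θ) : IsSmoothFrom θ := hθ.1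

lemma IsAdmissible.isSchwartz (hθ : IsAdmissible Ubar θ) {t : ℝ} (ht : 1 ≤ t) :
    IsSchwartz (fun x => θ x t) :=
  ⟨⟨_, hθ.isSmoothFrom.contDiff_slice ht, fun n k =>
    (hθ.2.2 n k t).imp fun _ hC x => hC x t ht le_rfl⟩, rfl⟩

lemma IsAdmissible.hasDerivAt_wordDeriv (hU : ContDiff ℝ (⊤ : ℕ∞) Ubar)
    (hθ : IsAdmissible Ubar θ) {t : ℝ} (ht : 1 < t) {w : List (Fin 3)}
    {T : (E3 → ℝ) → E3 → ℝ → ℝ}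
    (hT : ∀ f : E3 → ℝ, ContDiff ℝ (⊤ : ℕ∞) f → ∀ t, 1 ≤ t → ∀ x,
        wordDeriv w (fun y => ∑ i, ubar Ubar y t i * pd f i y) x
          = (∑ i, ubar Ubar x t i * pd (wordDeriv w f) i x) + T f x t) (x : E3) :
    HasDerivAt (fun s => wordDeriv w (fun y => θ y s) x)
      (lap (wordDeriv w fun y => θ y t) x
        - ((∑ i, ubar Ubar x t i * pd (wordDeriv w fun y => θ y t) i x)
          + T (fun y => θ y t) x t)) t := by
  have hf := hθ.isSmoothFrom.contDiff_slice ht.le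
  have h := hθ.isSmoothFrom.hasDerivAt_wordDeriv ht (fun y => by
    have h := hθ.isSmoothFrom.hasDerivAt_time y ht
    rw [← h.deriv, hθ.2.1 y t ht.le] at h
    exact h) w x
  rw [wordDeriv_sub (contDiff_lap hf) (ContDiff.sum fun i _ =>
    (contDiff_ubar hU t i).mul (contDiff_pd hf i)), wordDeriv_lap hf, hT _ hf t ht.le] at h
  exact h

lemma IsAdmissible.exists_bound (hθ : IsAdmissible Ubar θ) (τ : ℝ) (w : List (Fin 3)) :
    ∃ C, 0 ≤ C ∧ ∀ x t, 1 ≤ t → t ≤ τ →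
      |wordDeriv w (fun y => θ y t) x| ≤ C * (1 + ‖x‖) ^ (-4 : ℝ) := by
  obtain ⟨A, hA⟩ := hθ.2.2 0 w.length τ
  obtain ⟨B, hB⟩ := hθ.2.2 4 w.length τ
  refine ⟨8 * (|A| + |B|), by positivity, fun x t h1 h2 => ?_⟩
  have hw := abs_wordDeriv_le (hθ.isSmoothFrom.contDiff_slice h1) w x
  have hA' := (hA x t h1 h2).trans (le_abs_self A)
  have hB' := (hB x t h1 h2).trans (le_abs_self B)
  set N := ‖iteratedFDeriv ℝ w.length (fun y => θ y t) x‖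
  have hN : 0 ≤ N := norm_nonneg _
  have hx : (0 : ℝ) < (1 + ‖x‖) ^ 4 := by positivity
  rw [Real.rpow_neg (by positivity), ← div_eq_mul_inv,
    show (1 + ‖x‖) ^ (4 : ℝ) = (1 + ‖x‖) ^ 4 by exact_mod_cast Real.rpow_natCast _ 4,
    le_div_iff₀ hx]
  have h4 : (1 + ‖x‖) ^ 4 ≤ 8 * (1 + ‖x‖ ^ 4) := by
    have := add_pow_le (zero_le_one' ℝ) (norm_nonneg x) 4
    norm_num at this
    linarith
  calc |wordDeriv w (fun y => θ y t) x| * (1 + ‖x‖) ^ 4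
      ≤ N * (8 * (1 + ‖x‖ ^ 4)) := mul_le_mul hw h4 hx.le hN
    _ = 8 * (‖x‖ ^ 0 * N + ‖x‖ ^ 4 * N) := by ring
    _ ≤ 8 * (|A| + |B|) := by gcongr

lemma IsAdmissible.exists_bound_of_length_le (hθ : IsAdmissible Ubar θ) (τ : ℝ) (k : ℕ) :
    ∃ C, 0 ≤ C ∧ ∀ w : List (Fin 3), w.length ≤ k → ∀ x t, 1 ≤ t → t ≤ τ →
      |wordDeriv w (fun y => θ y t) x| ≤ C := by
  choose A hA using fun j => hθ.2.2 0 j τ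
  refine ⟨∑ j ∈ Finset.range (k + 1), |A j|, by positivity, fun w hw x t h1 h2 => ?_⟩
  have h := hA w.length x t h1 h2
  rw [pow_zero, one_mul] at h
  exact ((abs_wordDeriv_le (hθ.isSmoothFrom.contDiff_slice h1) w x).trans
    (h.trans (le_abs_self _))).trans (Finset.single_le_sum (f := fun j => |A j|)
      (fun _ _ => abs_nonneg _) (Finset.mem_range.2 (by omega)))

lemma integrable_japanese (C : ℝ) :
    Integrable (fun x : E3 => C * (1 + ‖x‖) ^ (-4 : ℝ)) :=
  (integrable_one_add_norm (by simp; norm_num)).const_mul C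

lemma IsAdmissible.continuousOn_integral_sq (hθ : IsAdmissible Ubar θ) (w : List (Fin 3)) :
    ContinuousOn (fun t => ∫ x, wordDeriv w (fun y => θ y t) x ^ 2) (Set.Ici 1) := by
  intro t ht
  have ht : 1 ≤ t := ht
  obtain ⟨C, hC0, hC⟩ := hθ.exists_bound (t + 1) w
  obtain ⟨D, hD0, hD⟩ := hθ.exists_bound_of_length_le (t + 1) w.length
  have hnear : ∀ᶠ s in nhdsWithin t (Set.Ici 1), 1 ≤ s ∧ s ≤ t + 1 := by
    filter_upwards [self_mem_nhdsWithin,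
      nhdsWithin_le_nhds (gt_mem_nhds (lt_add_one t))] with s h1 h2
    exact ⟨h1, h2.le⟩
  refine continuousWithinAt_of_dominated (bound := fun x => D * C * (1 + ‖x‖) ^ (-4 : ℝ))
    ?_ ?_ (integrable_japanese _) (ae_of_all _ fun x => ?_)
  · filter_upwards [hnear] with s hs
    exact ((hθ.isSchwartz hs.1).wordPartial w).integrable_sq.aestronglyMeasurable
  · filter_upwards [hnear] with s hs
    refine ae_of_all _ fun x => ?_
    rw [norm_pow, pow_two, Real.norm_eq_abs, mul_assoc]
    exact mul_le_mul (hD w le_rfl x s hs.1 hs.2) (hC x s hs.1 hs.2) (abs_nonneg _) hD0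
  · exact ((hθ.isSmoothFrom.wordDeriv w).continuousOn_time x t ht).pow 2

lemma IsAdmissible.hasDerivAt_integral_sq (hU : ContDiff ℝ (⊤ : ℕ∞) Ubar)
    (hUc : HasCompactSupport Ubar)
    (hθ : IsAdmissible Ubar θ) {t : ℝ} (ht : 1 < t) {w : List (Fin 3)} {k : ℕ}
    {T : (E3 → ℝ) → E3 → ℝ → ℝ} (hTk : IsLowerOrder k T)
    (hT : ∀ f : E3 → ℝ, ContDiff ℝ (⊤ : ℕ∞) f → ∀ t, 1 ≤ t → ∀ x,
        wordDeriv w (fun y => ∑ i, ubar Ubar y t i * pd f i y) x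
          = (∑ i, ubar Ubar x t i * pd (wordDeriv w f) i x) + T f x t) :
    HasDerivAt (fun s => ∫ x, wordDeriv w (fun y => θ y s) x ^ 2)
      (∫ x, 2 * (wordDeriv w (fun y => θ y t) x * (lap (wordDeriv w fun y => θ y t) x
        - ((∑ i, ubar Ubar x t i * pd (wordDeriv w fun y => θ y t) i x)
          + T (fun y => θ y t) x t)))) t := by
  obtain ⟨C, hC0, hC⟩ := hθ.exists_bound (t + 1) w
  obtain ⟨D, hD0, hD⟩ := hθ.exists_bound_of_length_le (t + 1) (w.length + 2 + k)
  obtain ⟨B, hB⟩ := exists_ubar_bound hU hUc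
  obtain ⟨A, hA0, hA⟩ := hTk.exists_bound
  have hB0 : 0 ≤ B := (abs_nonneg _).trans (hB 0 0 1 le_rfl)
  have hS : Set.Ioo 1 (t + 1) ∈ nhds t := Ioo_mem_nhds ht (lt_add_one t)
  refine (hasDerivAt_integral_of_dominated_loc_of_deriv_le (μ := volume) (s := Set.Ioo 1 (t + 1))
    (F := fun s x => wordDeriv w (fun y => θ y s) x ^ 2)
    (F' := fun s x => 2 * (wordDeriv w (fun y => θ y s) x * (lap (wordDeriv w fun y => θ y s) x
        - ((∑ i, ubar Ubar x s i * pd (wordDeriv w fun y => θ y s) i x)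
          + T (fun y => θ y s) x s))))
    (bound := fun x => 2 * (C * (3 * D + (3 * (B * D) + A * D))) * (1 + ‖x‖) ^ (-4 : ℝ))
    hS ?_ ?_ ?_ ?_ (integrable_japanese _) ?_).2
  · filter_upwards [hS] with s hs
    exact ((hθ.isSchwartz hs.1.le).wordPartial w).integrable_sq.aestronglyMeasurable
  · exact ((hθ.isSchwartz ht.le).wordPartial w).integrable_sq
  · have hf := (hθ.isSchwartz ht.le).contDiff
    have hw := contDiff_wordDeriv hf w
    refine Continuous.aestronglyMeasurable (continuous_const.mul (hw.continuous.mul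
      ((contDiff_lap hw).continuous.sub (Continuous.add ?_ (hTk.contDiff hf ht.le).continuous))))
    exact continuous_finsetSum _ fun i _ =>
      (contDiff_ubar hU t i).continuous.mul (contDiff_pd hw i).continuous
  · refine ae_of_all _ fun x s hs => ?_
    have h1 : 1 ≤ s := hs.1.le
    have h2 : s ≤ t + 1 := hs.2.le
    have hlap : |lap (wordDeriv w fun y => θ y s) x| ≤ 3 * D := by
      refine (Finset.abs_sum_le_sum_abs _ _).trans ((Finset.sum_le_sum (g := fun _ => D)
        fun i _ => hD (i :: i :: w) (by simp) x s h1 h2).trans (by simp))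
    have htr : |∑ i, ubar Ubar x s i * pd (wordDeriv w fun y => θ y s) i x|
        ≤ 3 * (B * D) := by
      refine (Finset.abs_sum_le_sum_abs _ _).trans ((Finset.sum_le_sum (g := fun _ => B * D)
        fun i _ => ?_).trans (by simp))
      rw [abs_mul]
      exact mul_le_mul (hB i x s h1) (hD (i :: w) (by simp; omega) x s h1 h2)
        (abs_nonneg _) hB0
    have hTb : |T (fun y => θ y s) x s| ≤ A * D :=
      hA _ s x D h1 fun v hv => hD v (by omega) x s h1 h2
    have hsum := (abs_sub _ _).trans (add_le_add hlap
      ((abs_add_le _ _).trans (add_le_add htr hTb)))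
    rw [Real.norm_eq_abs, abs_mul, abs_mul, abs_two]
    have := mul_le_mul (hC x s h1 h2) hsum (abs_nonneg _) (by positivity)
    linarith
  · refine ae_of_all _ fun x s hs => ?_
    have := (hθ.hasDerivAt_wordDeriv hU hs.1 hT x).pow 2
    refine this.congr_deriv ?_
    norm_num [mul_assoc]

lemma IsAdmissible.exists_energy_inequality (hU : ContDiff ℝ (⊤ : ℕ∞) Ubar)
    (hUc : HasCompactSupport Ubar) (hUdiv : ∀ x, divg Ubar x = 0) (w : List (Fin 3)) :
    ∃ C, 0 ≤ C ∧ ∀ θ, IsAdmissible Ubar θ → ∀ t, 1 < t → ∃ E',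
      HasDerivAt (fun s => ∫ x, wordDeriv w (fun y => θ y s) x ^ 2) E' t ∧
      E' ≤ -2 * (∑ i, ∫ x, pd (wordDeriv w fun y => θ y t) i x ^ 2)
        + C * t⁻¹ * ∑ m ∈ Finset.Icc 1 w.length, energy m (fun y => θ y t) := by
  obtain ⟨T, hTk, hT⟩ := exists_commutator hU hUc w
  obtain ⟨C, hC0, hC⟩ := hTk.exists_integral_bound rfl
  obtain ⟨B, hB⟩ := exists_ubar_bound hU hUc
  refine ⟨2 * C, by positivity, fun θ hθ t ht =>
    ⟨_, hθ.hasDerivAt_integral_sq hU hUc ht hTk hT, ?_⟩⟩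
  have hf := hθ.isSchwartz ht.le
  obtain ⟨hI, hb⟩ := hC _ hf t ht.le
  have hw := hf.wordPartial w
  set g := wordDeriv w fun y => θ y t with hg
  have hI1 : Integrable (fun x => g x * lap g x) := by
    simp_rw [lap, Finset.mul_sum]
    exact integrable_finsetSum _ fun i _ =>
      hw.integrable_mul ((hw.partialDeriv i).partialDeriv i)
  have hI2 : Integrable (fun x => g x * ∑ i, ubar Ubar x t i * pd g i x) := by
    simp_rw [Finset.mul_sum]
    refine integrable_finsetSum _ fun i _ => ?_
    refine (hw.integrable_bdd_mul_mul (hw.partialDeriv i) (contDiff_ubar hU t i).continuous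
      fun x => hB i x t ht.le).congr (ae_of_all _ fun x => ?_)
    change ubar Ubar x t i * (g x * pd g i x) = g x * (ubar Ubar x t i * pd g i x)
    ring
  choose D hD using fun i => (isCoeff_pd_ubar hU hUc i i).2 []
  have hzero : ∫ x, g x * ∑ i, ubar Ubar x t i * pd g i x = 0 := by
    refine hw.integral_mul_transport (b := fun i x => ubar Ubar x t i)
      (C := |B| + ∑ i, |D i * t⁻¹|) (contDiff_ubar hU t) (fun i x => ?_) (fun i x => ?_)
      (fun x => sum_pd_ubar hU hUdiv x t)
    · have : 0 ≤ ∑ i, |D i * t⁻¹| := by positivity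
      linarith [hB i x t ht.le, le_abs_self B]
    · have h1 := hD i x t ht.le
      have h2 := Finset.single_le_sum (f := fun i => |D i * t⁻¹|) (fun _ _ => abs_nonneg _)
        (Finset.mem_univ i)
      have h3 := (h1.trans (le_abs_self _)).trans h2
      exact h3.trans (le_add_of_nonneg_left (abs_nonneg B))
  have hsplit : ∀ x, 2 * (g x * (lap g x - ((∑ i, ubar Ubar x t i * pd g i x)
      + T (fun y => θ y t) x t))) = 2 * (g x * lap g x
      - (g x * (∑ i, ubar Ubar x t i * pd g i x) + g x * T (fun y => θ y t) x t)) :=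
    fun x => by ring
  have hI3 : Integrable (fun x => g x * (∑ i, ubar Ubar x t i * pd g i x)
      + g x * T (fun y => θ y t) x t) := hI2.add hI
  simp_rw [hsplit]
  rw [integral_const_mul, integral_sub hI1 hI3, integral_add hI2 hI,
    hzero, hw.integral_mul_lap]
  have := (neg_le_abs _).trans hb
  linarith

end TimeDependence

section Cascade

/-- A hierarchy of nonnegative energies on `[1, ∞)`, each dissipated by the next one up to an
error controlled by the lower ones. -/
def IsCascade (C : ℕ → ℝ) (E : ℕ → ℝ → ℝ) : Prop :=
  (∀ k t, 0 ≤ E k t) ∧ (∀ k, ContinuousOn (E k) (Set.Ici 1)) ∧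
  ∀ k t, 1 < t → ∃ E', HasDerivAt (E k) E' t ∧
    E' ≤ -2 * E (k + 1) t + C k * t⁻¹ * ∑ m ∈ Finset.Icc 1 k, E m t

/-- The primitive on `[1, ∞)` of a function continuous there. -/
def primitiveFrom (e : ℝ → ℝ) (t : ℝ) : ℝ := ∫ s in (1 : ℝ)..t, e (max 1 s)

variable {e f : ℝ → ℝ} {C : ℕ → ℝ} {E : ℕ → ℝ → ℝ} {t : ℝ}

lemma hasDerivAt_primitiveFrom (he : ContinuousOn e (Set.Ici 1)) (ht : 1 ≤ t) :
    HasDerivAt (primitiveFrom e) (e t) t := by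
  have hc : Continuous fun s => e (max 1 s) :=
    he.comp_continuous (by fun_prop) fun s => le_max_left 1 s
  have h := hc.integral_hasStrictDerivAt 1 t
  rw [max_eq_right ht] at h
  exact h.hasDerivAt

lemma primitiveFrom_one (e : ℝ → ℝ) : primitiveFrom e 1 = 0 :=
  intervalIntegral.integral_same

lemma primitiveFrom_nonneg (he : ∀ t, 0 ≤ e t) (ht : 1 ≤ t) : 0 ≤ primitiveFrom e t :=
  intervalIntegral.integral_nonneg ht fun _ _ => he _

lemma le_of_hasDerivAt_nonpos (hf : ContinuousOn f (Set.Ici 1))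
    (hf' : ∀ t, 1 < t → ∃ f', HasDerivAt f f' t ∧ f' ≤ 0) (ht : 1 ≤ t) : f t ≤ f 1 := by
  refine antitoneOn_of_deriv_nonpos (convex_Ici 1) hf (fun s hs => ?_) (fun s hs => ?_)
    (Set.mem_Ici.2 le_rfl) ht ht
  all_goals
    rw [interior_Ici] at hs
    obtain ⟨f', h, h'⟩ := hf' s hs
  · exact h.differentiableAt.differentiableWithinAt
  · rwa [h.deriv]

namespace IsCascade

lemma continuousOn_primitiveFrom (h : IsCascade C E) (k : ℕ) :
    ContinuousOn (primitiveFrom (E k)) (Set.Ici 1) := fun _ ht =>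
  (hasDerivAt_primitiveFrom (h.2.1 k) ht).continuousAt.continuousWithinAt

lemma sum_nonneg (h : IsCascade C E) (k : ℕ) (t : ℝ) : 0 ≤ ∑ m ∈ Finset.Icc 1 k, E m t :=
  Finset.sum_nonneg fun m _ => h.1 m t

lemma energy_le (h : IsCascade C E) (hC : ∀ k, 0 ≤ C k) (k : ℕ) (ht : 1 ≤ t) :
    E k t + 2 * primitiveFrom (E (k + 1)) t
      ≤ E k 1 + C k * ∑ m ∈ Finset.Icc 1 k, primitiveFrom (E m) t := by
  have key := le_of_hasDerivAt_nonpos (f := fun t => E k t + 2 * primitiveFrom (E (k + 1)) t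
    - C k * ∑ m ∈ Finset.Icc 1 k, primitiveFrom (E m) t) ?_ (fun t ht => ?_) ht
  · simp only [primitiveFrom_one, Finset.sum_const_zero, mul_zero, add_zero, sub_zero] at key
    linarith
  · exact ((h.2.1 k).add (continuousOn_const.mul (h.continuousOn_primitiveFrom _))).sub
      (continuousOn_const.mul (continuousOn_finsetSum _ fun m _ =>
        h.continuousOn_primitiveFrom m))
  · obtain ⟨E', hE', hle⟩ := h.2.2 k t ht
    refine ⟨_, (hE'.add ((hasDerivAt_primitiveFrom (h.2.1 (k + 1)) ht.le).const_mul 2)).sub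
      ((HasDerivAt.fun_sum fun m _ => hasDerivAt_primitiveFrom (h.2.1 m) ht.le).const_mul (C k)),
      ?_⟩
    have := mul_le_mul_of_nonneg_right (mul_le_of_le_one_right (hC k)
      (inv_le_one_of_one_le₀ ht.le)) (h.sum_nonneg k t)
    linarith

lemma weighted_energy_le (h : IsCascade C E) (hC : ∀ k, 0 ≤ C k) (k : ℕ) (ht : 1 ≤ t) :
    (t - 1) * E k t
      ≤ primitiveFrom (E k) t + C k * ∑ m ∈ Finset.Icc 1 k, primitiveFrom (E m) t := by
  have key := le_of_hasDerivAt_nonpos (f := fun t => (t - 1) * E k t - primitiveFrom (E k) t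
    - C k * ∑ m ∈ Finset.Icc 1 k, primitiveFrom (E m) t) ?_ (fun t ht => ?_) ht
  · simp only [primitiveFrom_one, Finset.sum_const_zero, mul_zero, sub_self, zero_mul] at key
    linarith
  · exact (((by fun_prop : ContinuousOn (fun t : ℝ => t - 1) _).mul (h.2.1 k)).sub
      (h.continuousOn_primitiveFrom _)).sub (continuousOn_const.mul
        (continuousOn_finsetSum _ fun m _ => h.continuousOn_primitiveFrom m))
  · obtain ⟨E', hE', hle⟩ := h.2.2 k t ht
    refine ⟨_, ((((hasDerivAt_id t).sub_const 1).mul hE').sub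
      (hasDerivAt_primitiveFrom (h.2.1 k) ht.le)).sub
      ((HasDerivAt.fun_sum fun m _ => hasDerivAt_primitiveFrom (h.2.1 m) ht.le).const_mul (C k)),
      ?_⟩
    have ht0 : 0 < t := by linarith
    have h1 : (t - 1) * E' ≤ C k * ∑ m ∈ Finset.Icc 1 k, E m t := by
      have hq : (t - 1) * t⁻¹ ≤ 1 := by
        rw [sub_mul, mul_inv_cancel₀ ht0.ne']
        linarith [inv_pos.2 ht0]
      have hS := mul_nonneg (hC k) (h.sum_nonneg k t)
      calc (t - 1) * E' ≤ (t - 1) * (C k * t⁻¹ * ∑ m ∈ Finset.Icc 1 k, E m t) :=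
            mul_le_mul_of_nonneg_left (by linarith [h.1 (k + 1) t]) (by linarith)
        _ = ((t - 1) * t⁻¹) * (C k * ∑ m ∈ Finset.Icc 1 k, E m t) := by ring
        _ ≤ _ := mul_le_of_le_one_left hS hq
    simp only [id]
    linarith

lemma exists_sum_primitiveFrom_le (hC : ∀ k, 0 ≤ C k) (k : ℕ) :
    ∃ B, 0 ≤ B ∧ ∀ E, IsCascade C E → ∀ t, 1 ≤ t →
      ∑ m ∈ Finset.Icc 1 k, primitiveFrom (E m) t ≤ B * ∑ j ∈ Finset.range k, E j 1 := by
  induction k with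
  | zero => exact ⟨0, le_rfl, fun _ _ _ _ => by simp⟩
  | succ k ih =>
    obtain ⟨B, hB0, hB⟩ := ih
    have hCk := hC k
    refine ⟨B + (1 + C k * B), by positivity, fun E h t ht => ?_⟩
    rw [Finset.sum_Icc_succ_top (by omega), Finset.sum_range_succ]
    have h1 := h.energy_le hC k ht
    have h2 := primitiveFrom_nonneg (h.1 (k + 1)) ht
    have h3 := mul_le_mul_of_nonneg_left (hB E h t ht) hCk
    have h4 : 0 ≤ ∑ j ∈ Finset.range k, E j 1 := Finset.sum_nonneg fun j _ => h.1 j 1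
    have h5 := mul_nonneg (mul_nonneg hCk hB0) (h.1 k 1)
    have h6 := mul_nonneg hB0 (h.1 k 1)
    linarith [hB E h t ht, h.1 k t]

lemma exists_decay (hC : ∀ k, 0 ≤ C k) {k : ℕ} (hk : 1 ≤ k) :
    ∃ A, 0 ≤ A ∧ ∀ E, IsCascade C E → ∀ t, 1 < t →
      E k t ≤ A * (t - 1)⁻¹ * ∑ j ∈ Finset.range k, E j 1 := by
  obtain ⟨B, hB0, hB⟩ := exists_sum_primitiveFrom_le hC k
  have hCk := hC k
  refine ⟨(1 + C k) * B, by positivity, fun E h t ht => ?_⟩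
  have h1 := h.weighted_energy_le hC k ht.le
  have h2 := Finset.single_le_sum (f := fun m => primitiveFrom (E m) t)
    (fun m _ => primitiveFrom_nonneg (h.1 m) ht.le) (Finset.mem_Icc.2 ⟨hk, le_rfl⟩)
  have h3 := mul_le_mul_of_nonneg_left (hB E h t ht.le) (by positivity : 0 ≤ 1 + C k)
  rw [mul_right_comm, ← div_eq_mul_inv, le_div_iff₀ (by linarith)]
  linarith

end IsCascade

end Cascade

lemma exists_isCascade_energy {Ubar : E3 → E3} (hU : ContDiff ℝ (⊤ : ℕ∞) Ubar)
    (hUc : HasCompactSupport Ubar) (hUdiv : ∀ x, divg Ubar x = 0) :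
    ∃ C : ℕ → ℝ, (∀ k, 0 ≤ C k) ∧ ∀ θ, IsAdmissible Ubar θ →
      IsCascade C (fun k t => energy k (fun x => θ x t)) := by
  choose c hc0 hc using IsAdmissible.exists_energy_inequality hU hUc hUdiv
  refine ⟨fun k => ∑ w : Fin k → Fin 3, c (List.ofFn w),
    fun k => Finset.sum_nonneg fun w _ => hc0 _, fun θ hθ => ⟨fun k t => energy_nonneg _ _,
    fun k => continuousOn_finsetSum _ fun w _ => hθ.continuousOn_integral_sq _,
    fun k t ht => ?_⟩⟩
  choose E' hE' hle using fun w : Fin k → Fin 3 => hc (List.ofFn w) θ hθ t ht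
  refine ⟨∑ w, E' w, HasDerivAt.fun_sum fun w _ => hE' w,
    (Finset.sum_le_sum fun w _ => hle w).trans (le_of_eq ?_)⟩
  simp only [List.length_ofFn]
  rw [Finset.sum_add_distrib, ← Finset.mul_sum, ← energy_succ, ← Finset.sum_mul,
    ← Finset.sum_mul]

/-- **Smoothing estimate for the advected heat equation.**  For every integer `k ≥ 1`
there is `C = C(k, Ū)` such that any admissible solution of `∂ₜθ = Δθ − ū·∇θ` on `[1,∞)`
satisfies `‖∇^k θ(t)‖²_{L²} ≤ C (t−1)^{-1} ‖θ(1)‖²_{H^{k−1}}` for all `t > 1`. -/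
theorem advected_heat_derivative_decay
    (Ubar : E3 → E3) (hU : ContDiff ℝ (⊤ : ℕ∞) Ubar) (hUc : HasCompactSupport Ubar)
    (hUdiv : ∀ x, divg Ubar x = 0) :
    ∀ k : ℕ, 1 ≤ k → ∃ C : ℝ,
      ∀ θ : E3 → ℝ → ℝ, IsAdmissible Ubar θ →
        ∀ t : ℝ, 1 < t →
          (∫ x : E3, ‖iteratedFDeriv ℝ k (fun y => θ y t) x‖ ^ 2)
            ≤ C * (t - 1)⁻¹ * sobSq (k - 1) (fun x => θ x 1) := by
  intro k hk
  obtain ⟨C, hC0, hC⟩ := exists_isCascade_energy hU hUc hUdiv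
  obtain ⟨A, hA0, hA⟩ := IsCascade.exists_decay hC0 hk
  refine ⟨3 ^ k * A * 3 ^ k, fun θ hθ t ht => ?_⟩
  have ht' : 0 < (t - 1)⁻¹ := inv_pos.2 (by linarith)
  have hsum : ∑ j ∈ Finset.range k, energy j (fun x => θ x 1)
      ≤ 3 ^ k * sobSq (k - 1) (fun x => θ x 1) := by
    rw [sobSq, Nat.sub_add_cancel hk, Finset.mul_sum]
    refine Finset.sum_le_sum fun j hj => ((hθ.isSchwartz le_rfl).energy_le_integral j).trans ?_
    refine mul_le_mul_of_nonneg_right ?_ (integral_nonneg fun x => by positivity)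
    exact pow_le_pow_right₀ (by norm_num) (Finset.mem_range.1 hj).le
  calc (∫ x : E3, ‖iteratedFDeriv ℝ k (fun y => θ y t) x‖ ^ 2)
      ≤ 3 ^ k * energy k (fun y => θ y t) :=
        (hθ.isSchwartz ht.le).integral_norm_iteratedFDeriv_sq_le k
    _ ≤ 3 ^ k * (A * (t - 1)⁻¹ * (3 ^ k * sobSq (k - 1) (fun x => θ x 1))) := by
        gcongr
        exact (hA _ (hC θ hθ) t ht).trans (by gcongr)
    _ = 3 ^ k * A * 3 ^ k * (t - 1)⁻¹ * sobSq (k - 1) (fun x => θ x 1) := by ring
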